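/- arXiv:1701.04841 — 2 statements merged into one kernel-verified Lean document; each statement's English description precedes it below -/
import Mathlib

section
/- Let ρ⁰ ∈ P_o(G) and let ρ : [0,∞) → P_o(G) be a continuously differentiable solution of the Fokker–Planck equation ρ'(t) = −L(ρ(t))F(ρ(t)) with ρ(0) = ρ⁰. Then ρ_i(t) ≥ m(ρ⁰) > 0 for every i ∈ V and every t ≥ 0. -/
open Finset Filter Matrix
open scoped Classical

noncomputable section

namespace FPEGraph

variable {n : ℕ}

/-- Edge average `θ_{ij}(ρ) = (ρ_i + ρ_j)/2`. -/
def theta (ρ : Fin n → ℝ) (i j : Fin n) : ℝ := (ρ i + ρ j) / 2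

/-- Weighted graph Laplacian `L(ρ)`, satisfying
`(L(ρ)Φ)_i = ∑_{j} ω_{ij} θ_{ij}(ρ) (Φ_i - Φ_j)` (the sum over all `j` equals the
sum over neighbors since `ω_{ij} = 0` off edges). -/
def Lmat (ω : Fin n → Fin n → ℝ) (ρ : Fin n → ℝ) : Matrix (Fin n) (Fin n) ℝ :=
  fun i j => if i = j then ∑ k, ω i k * theta ρ i k else -(ω i j * theta ρ i j)

/-- Graph Laplacian `L̂`, with `(L̂Φ)_i = ∑_{j} ω_{ij} (Φ_i - Φ_j)`. -/
def Lhat (ω : Fin n → Fin n → ℝ) : Matrix (Fin n) (Fin n) ℝ :=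
  fun i j => if i = j then ∑ k, ω i k else -(ω i j)

/-- Connectivity of the weighted graph: any two vertices are joined by a chain of edges. -/
def Conn (ω : Fin n → Fin n → ℝ) : Prop :=
  ∀ i j : Fin n, Relation.ReflTransGen (fun a b => ω a b ≠ 0) i j

/-- `ω` encodes a connected undirected weighted graph without self-loops:
symmetric nonnegative weights, zero diagonal, connected (edges are pairs with `ω_{ij} > 0`,
i.e. `ω_{ij} ≠ 0`). -/
def IsGraph (ω : Fin n → Fin n → ℝ) : Prop :=
  (∀ i j, ω i j = ω j i) ∧ (∀ i, ω i i = 0) ∧ (∀ i j, 0 ≤ ω i j) ∧ Conn ω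

/-- The probability simplex `P(G)`. -/
def PG (ρ : Fin n → ℝ) : Prop := (∑ i, ρ i) = 1 ∧ ∀ i, 0 ≤ ρ i

/-- The interior `P_o(G)` of the probability simplex. -/
def PoG (ρ : Fin n → ℝ) : Prop := (∑ i, ρ i) = 1 ∧ ∀ i, 0 < ρ i

/-- Free energy `𝓕(ρ) = (1/2) ρᵀ𝕎ρ + 𝕍ᵀρ + β ∑ᵢ ρᵢ log ρᵢ`. -/
def freeEnergy (W : Matrix (Fin n) (Fin n) ℝ) (V : Fin n → ℝ) (β : ℝ) (ρ : Fin n → ℝ) : ℝ :=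
  (1/2) * (ρ ⬝ᵥ W.mulVec ρ) + V ⬝ᵥ ρ + β * ∑ i, ρ i * Real.log (ρ i)

/-- Gradient `F(ρ)` of the free energy, `F_i(ρ) = 𝕍_i + (𝕎ρ)_i + β log ρ_i + β`. -/
def gradF (W : Matrix (Fin n) (Fin n) ℝ) (V : Fin n → ℝ) (β : ℝ) (ρ : Fin n → ℝ) :
    Fin n → ℝ :=
  fun i => V i + W.mulVec ρ i + β * Real.log (ρ i) + β

/-- Hessian `Hess𝓕(ρ) = 𝕎 + β diag(1/ρ₁, …, 1/ρₙ)`. -/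
def hessF (W : Matrix (Fin n) (Fin n) ℝ) (β : ℝ) (ρ : Fin n → ℝ) :
    Matrix (Fin n) (Fin n) ℝ :=
  W + β • Matrix.diagonal (fun i => (ρ i)⁻¹)

/-- Gibbs measure: `ρ∞ ∈ P_o(G)` with `ρ∞_i = e^{-((𝕎ρ∞)_i + 𝕍_i)/β} / K`. -/
def IsGibbs (W : Matrix (Fin n) (Fin n) ℝ) (V : Fin n → ℝ) (β : ℝ) (ρ : Fin n → ℝ) : Prop :=
  PoG ρ ∧ ∀ i, ρ i = Real.exp (-(W.mulVec ρ i + V i) / β) /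
      ∑ j, Real.exp (-(W.mulVec ρ j + V j) / β)

/-- A continuously differentiable solution `ρ : [0,∞) → P_o(G)` of the Fokker–Planck
equation `ρ' = -L(ρ)F(ρ)`. -/
def IsSolution (ω : Fin n → Fin n → ℝ) (W : Matrix (Fin n) (Fin n) ℝ) (V : Fin n → ℝ)
    (β : ℝ) (ρ : ℝ → Fin n → ℝ) : Prop :=
  (∀ t ∈ Set.Ici (0:ℝ), PoG (ρ t)) ∧
  ∀ t ∈ Set.Ici (0:ℝ),
    HasDerivWithinAt ρ (-(Lmat ω (ρ t)).mulVec (gradF W V β (ρ t))) (Set.Ici 0) t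

/-- `M = e^{2 max_{i,j}(|𝕍_i| + |𝕎_{ij}|)}`. -/
def Mconst (W : Matrix (Fin n) (Fin n) ℝ) (V : Fin n → ℝ) : ℝ :=
  Real.exp (2 * ⨆ i : Fin n, ⨆ j : Fin n, (|V i| + |W i j|))

/-- `m(ρ⁰) = (1/2) (1/(1+(2M)^{1/β}))^{n-2} min{1/(1+(2M)^{1/β}), minᵢ ρ⁰ᵢ}`. -/
def mconst (W : Matrix (Fin n) (Fin n) ℝ) (V : Fin n → ℝ) (β : ℝ) (ρ0 : Fin n → ℝ) : ℝ :=
  (1/2) * (1 / (1 + (2 * Mconst W V) ^ (1/β)))^(n-2) *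
    min (1 / (1 + (2 * Mconst W V) ^ (1/β))) (⨅ i, ρ0 i)

/-- Second smallest eigenvalue (via the Rayleigh quotient on the orthogonal complement of
the constants; for the symmetric PSD Laplacians considered here, whose kernel is spanned by
the constant vector, this is exactly the second-smallest eigenvalue with multiplicity). -/
def lamSec (A : Matrix (Fin n) (Fin n) ℝ) : ℝ :=
  sInf {x | ∃ Φ : Fin n → ℝ, (∑ i, Φ i) = 0 ∧ (∑ i, (Φ i)^2) = 1 ∧ x = Φ ⬝ᵥ A.mulVec Φ}

/-- Largest eigenvalue of a symmetric matrix, via the Rayleigh quotient. -/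
def lamMax (A : Matrix (Fin n) (Fin n) ℝ) : ℝ :=
  sSup {x | ∃ Φ : Fin n → ℝ, (∑ i, (Φ i)^2) = 1 ∧ x = Φ ⬝ᵥ A.mulVec Φ}

/-- Maximum absolute column sum norm `‖A‖₁`. -/
def matNorm1 (A : Matrix (Fin n) (Fin n) ℝ) : ℝ := ⨆ j : Fin n, ∑ i, |A i j|

/-- Maximal vertex degree `Deg(G)`. -/
def maxDeg (ω : Fin n → Fin n → ℝ) : ℕ :=
  Finset.univ.sup fun i => (Finset.univ.filter fun j => ω i j ≠ 0).card

/-- Maximal edge weight `max_{(i,j)∈E} ω_{ij}` (equal to the max over all pairs since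
`ω = 0` off edges and weights are positive on edges). -/
def maxWeight (ω : Fin n → Fin n → ℝ) : ℝ := ⨆ i : Fin n, ⨆ j : Fin n, ω i j

/-- A vector field on `G`: a skew-symmetric matrix vanishing off edges. -/
def IsVF (ω : Fin n → Fin n → ℝ) (v : Fin n → Fin n → ℝ) : Prop :=
  (∀ i j, v i j = - v j i) ∧ ∀ i j, ω i j = 0 → v i j = 0

/-- Potential vector field `(∇_G Φ)_{ij} = √ω_{ij} (Φ_i - Φ_j)` (this vanishes off edges
since `ω_{ij} = 0` there). -/
def gradG (ω : Fin n → Fin n → ℝ) (Φ : Fin n → ℝ) : Fin n → Fin n → ℝ :=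
  fun i j => Real.sqrt (ω i j) * (Φ i - Φ j)

/-- Divergence `div_G(ρv)_i = -∑_j √ω_{ij} v_{ij} θ_{ij}(ρ)` (sum over all `j` equals the
sum over neighbors since `√ω_{ij} = 0` off edges). -/
def divG (ω : Fin n → Fin n → ℝ) (ρ : Fin n → ℝ) (v : Fin n → Fin n → ℝ) : Fin n → ℝ :=
  fun i => -∑ j, Real.sqrt (ω i j) * v i j * theta ρ i j

/-- Inner product `(v,w)_ρ = (1/2) ∑_{(i,j)∈E} v_{ij} w_{ij} θ_{ij}(ρ)`. -/
def innerG (ω : Fin n → Fin n → ℝ) (ρ : Fin n → ℝ) (v w : Fin n → Fin n → ℝ) : ℝ :=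
  (1/2) * ∑ i, ∑ j, if ω i j ≠ 0 then v i j * w i j * theta ρ i j else 0


/-- A finite family of functions on `[0,∞)`, positive at `0`, stays positive if each member that
reaches `0` while all of them are nonnegative has positive derivative there. -/
theorem pos_of_deriv_pos_at_zero {ι : Type*} [Finite ι] (g g' : ι → ℝ → ℝ)
    (hg : ∀ k, ∀ t ∈ Set.Ici (0:ℝ), HasDerivWithinAt (g k) (g' k t) (Set.Ici 0) t)
    (h0 : ∀ k, 0 < g k 0)
    (hpos : ∀ t ∈ Set.Ici (0:ℝ), (∀ l, 0 ≤ g l t) → ∀ k, g k t = 0 → 0 < g' k t) :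
    ∀ t ∈ Set.Ici (0:ℝ), ∀ k, 0 < g k t := by
  intro t₀ ht₀ k₀
  by_contra! hbad
  have hcont : ∀ k, ContinuousOn (g k) (Set.Icc 0 t₀) := fun k t ht =>
    ((hg k t ht.1).continuousWithinAt).mono Set.Icc_subset_Ici_self
  have hclosed : IsClosed (⋃ k, Set.Icc 0 t₀ ∩ g k ⁻¹' Set.Iic 0) :=
    isClosed_iUnion_of_finite fun k =>
      (hcont k).preimage_isClosed_of_isClosed isClosed_Icc isClosed_Iic
  have hcomp : IsCompact (⋃ k, Set.Icc 0 t₀ ∩ g k ⁻¹' Set.Iic 0) :=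
    isCompact_Icc.of_isClosed_subset hclosed
      (Set.iUnion_subset fun k => Set.inter_subset_left)
  obtain ⟨T, hT, hleast⟩ := hcomp.exists_isLeast
    ⟨t₀, Set.mem_iUnion.2 ⟨k₀, ⟨ht₀, le_rfl⟩, hbad⟩⟩
  obtain ⟨k, ⟨hT0, hTt⟩, hk⟩ := Set.mem_iUnion.1 hT
  have hk : g k T ≤ 0 := hk
  have hbefore : ∀ s, 0 ≤ s → s < T → ∀ l, 0 < g l s := by
    intro s hs hsT l
    by_contra! hl
    exact absurd (hleast (Set.mem_iUnion.2 ⟨l, ⟨hs, hsT.le.trans hTt⟩, hl⟩)) (not_le.2 hsT)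
  have hTpos : 0 < T := by
    rcases hT0.lt_or_eq with h | h
    · exact h
    · exact absurd (h0 k) (not_lt.2 (h ▸ hk))
  have hderiv : ∀ l, HasDerivAt (g l) (g' l T) T := fun l =>
    (hg l T hT0).hasDerivAt (Ici_mem_nhds hTpos)
  have hev : ∀ᶠ s in nhdsWithin T (Set.Iio T), 0 < s ∧ s < T := by
    filter_upwards [Ioo_mem_nhdsLT hTpos] with s hs using hs
  have hnonneg : ∀ l, 0 ≤ g l T := fun l =>
    ge_of_tendsto ((hderiv l).continuousAt.tendsto.mono_left nhdsWithin_le_nhds)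
      (hev.mono fun s hs => (hbefore s hs.1.le hs.2 l).le)
  have hzero : g k T = 0 := le_antisymm hk (hnonneg k)
  have hslope := (hasDerivWithinAt_iff_tendsto_slope' (s := Set.Iio T) (by simp)).1
    ((hderiv k).hasDerivWithinAt (s := Set.Iio T))
  refine absurd (hpos T hT0 hnonneg k hzero) (not_lt.2 (le_of_tendsto hslope ?_))
  filter_upwards [hev] with s hs
  rw [slope_def_field, hzero]
  exact div_nonpos_of_nonneg_of_nonpos (by linarith [hbefore s hs.1.le hs.2 k])
    (by linarith [hs.2])

theorem Lmat_mulVec {ω : Fin n → Fin n → ℝ} (hdiag : ∀ i, ω i i = 0) (ρ Φ : Fin n → ℝ)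
    (i : Fin n) :
    (Lmat ω ρ).mulVec Φ i = ∑ j, ω i j * theta ρ i j * (Φ i - Φ j) := by
  have h : ∀ j, Lmat ω ρ i j * Φ j =
      (if i = j then (∑ k, ω i k * theta ρ i k) * Φ i else 0) - ω i j * theta ρ i j * Φ j := by
    intro j
    unfold Lmat
    split_ifs with hij
    · subst hij; simp [hdiag]
    · ring
  simp only [Matrix.mulVec, dotProduct, h, Finset.sum_sub_distrib, mul_sub]
  simp [Finset.sum_mul]

theorem sum_sum_eq_zero_of_antisymm {ι : Type*} (B : Finset ι) (a : ι → ι → ℝ)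
    (ha : ∀ i j, a i j = -a j i) : ∑ i ∈ B, ∑ j ∈ B, a i j = 0 := by
  have h : ∑ i ∈ B, ∑ j ∈ B, a i j = -∑ i ∈ B, ∑ j ∈ B, a i j := by
    conv_rhs => rw [Finset.sum_comm]
    simp only [← Finset.sum_neg_distrib, ← ha]
  linarith

/-- Only edges leaving `B` contribute to the total flux into `B`. -/
theorem sum_neg_Lmat_mulVec {ω : Fin n → Fin n → ℝ} (hsymm : ∀ i j, ω i j = ω j i)
    (hdiag : ∀ i, ω i i = 0) (ρ Φ : Fin n → ℝ) (B : Finset (Fin n)) :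
    ∑ i ∈ B, (-(Lmat ω ρ).mulVec Φ) i =
      ∑ i ∈ B, ∑ j ∈ Bᶜ, ω i j * theta ρ i j * (Φ j - Φ i) := by
  have h : ∀ i, (-(Lmat ω ρ).mulVec Φ) i = ∑ j ∈ B, ω i j * theta ρ i j * (Φ j - Φ i) +
      ∑ j ∈ Bᶜ, ω i j * theta ρ i j * (Φ j - Φ i) := by
    intro i
    rw [Pi.neg_apply, Lmat_mulVec hdiag, Finset.sum_add_sum_compl, ← Finset.sum_neg_distrib]
    exact Finset.sum_congr rfl fun j _ => by ring
  simp only [h, Finset.sum_add_distrib]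
  rw [sum_sum_eq_zero_of_antisymm, zero_add]
  intro i j
  rw [hsymm i j, theta, theta]
  ring

theorem Conn.exists_edge_leaving {ω : Fin n → Fin n → ℝ} (h : Conn ω) {B : Finset (Fin n)}
    {a b : Fin n} (ha : a ∈ B) (hb : b ∉ B) : ∃ i ∈ B, ∃ j ∉ B, ω i j ≠ 0 := by
  by_contra! hno
  refine hb ?_
  clear hb
  induction h a b with
  | refl => exact ha
  | @tail c d _ hcd ih =>
    by_contra hd
    exact hcd (hno c ih d hd)

/-- The exponent defining `Mconst`. -/
def potentialBound (W : Matrix (Fin n) (Fin n) ℝ) (V : Fin n → ℝ) : ℝ :=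
  ⨆ i : Fin n, ⨆ j : Fin n, (|V i| + |W i j|)

theorem le_potentialBound (W : Matrix (Fin n) (Fin n) ℝ) (V : Fin n → ℝ) (i j : Fin n) :
    |V i| + |W i j| ≤ potentialBound W V :=
  (le_ciSup (f := fun j => |V i| + |W i j|) (Set.finite_range _).bddAbove j).trans
    (le_ciSup (f := fun i => ⨆ j, (|V i| + |W i j|)) (Set.finite_range _).bddAbove i)

theorem abs_potential_le (W : Matrix (Fin n) (Fin n) ℝ) (V : Fin n → ℝ) {ρ : Fin n → ℝ}
    (hρ : PG ρ) (i : Fin n) : |V i + W.mulVec ρ i| ≤ potentialBound W V := by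
  have h : V i + W.mulVec ρ i = ∑ j, (V i + W i j) * ρ j := by
    simp only [add_mul, Finset.sum_add_distrib, ← Finset.mul_sum, hρ.1, mul_one,
      Matrix.mulVec, dotProduct]
  rw [h]
  calc |∑ j, (V i + W i j) * ρ j| ≤ ∑ j, |(V i + W i j) * ρ j| :=
        Finset.abs_sum_le_sum_abs _ _
    _ ≤ ∑ j, potentialBound W V * ρ j := by
        refine Finset.sum_le_sum fun j _ => ?_
        rw [abs_mul, abs_of_nonneg (hρ.2 j)]
        exact mul_le_mul_of_nonneg_right
          ((abs_add_le _ _).trans (le_potentialBound W V i j)) (hρ.2 j)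
    _ = potentialBound W V := by rw [← Finset.mul_sum, hρ.1, mul_one]

theorem gradF_lt_gradF (W : Matrix (Fin n) (Fin n) ℝ) (V : Fin n → ℝ) {β : ℝ} (hβ : 0 < β)
    {ρ : Fin n → ℝ} (hρ : PoG ρ) {i j : Fin n}
    (hij : (2 * Mconst W V) ^ (1 / β) * ρ i ≤ ρ j) :
    gradF W V β ρ i < gradF W V β ρ j := by
  have hM : (0:ℝ) < 2 * Mconst W V := mul_pos two_pos (Real.exp_pos _)
  have hlog := Real.log_le_log (mul_pos (Real.rpow_pos_of_pos hM _) (hρ.2 i)) hij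
  rw [Real.log_mul (Real.rpow_pos_of_pos hM _).ne' (hρ.2 i).ne', Real.log_rpow hM,
    Mconst, Real.log_mul two_ne_zero (Real.exp_pos _).ne', Real.log_exp] at hlog
  have hlog' := mul_le_mul_of_nonneg_left hlog hβ.le
  rw [mul_add, ← mul_assoc, mul_one_div_cancel hβ.ne', one_mul] at hlog'
  have hi := abs_le.1 (abs_potential_le W V ⟨hρ.1, fun k => (hρ.2 k).le⟩ i)
  have hj := abs_le.1 (abs_potential_le W V ⟨hρ.1, fun k => (hρ.2 k).le⟩ j)
  have h2 : 0 < Real.log 2 := Real.log_pos one_lt_two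
  change _ + 2 * potentialBound W V + _ ≤ _ at hlog'
  unfold gradF
  linarith [hi.2, hj.1]

/-- If every vertex outside `B` carries much more mass than every vertex of `B`, then mass flows
into `B`. -/
theorem flux_pos {ω : Fin n → Fin n → ℝ} (hG : IsGraph ω) (W : Matrix (Fin n) (Fin n) ℝ)
    (V : Fin n → ℝ) {β : ℝ} (hβ : 0 < β) {ρ : Fin n → ℝ} (hρ : PoG ρ) {B : Finset (Fin n)}
    (hne : B.Nonempty) (hproper : B ≠ Finset.univ)
    (hB : ∀ i ∈ B, ∀ j ∉ B, (2 * Mconst W V) ^ (1 / β) * ρ i ≤ ρ j) :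
    0 < ∑ i ∈ B, (-(Lmat ω ρ).mulVec (gradF W V β ρ)) i := by
  obtain ⟨hsymm, hdiag, hnonneg, hconn⟩ := hG
  obtain ⟨a, ha⟩ := hne
  obtain ⟨b, hb⟩ : ∃ b, b ∉ B := by
    by_contra! h
    exact hproper (Finset.eq_univ_iff_forall.2 h)
  obtain ⟨i, hi, j, hj, hij⟩ := hconn.exists_edge_leaving ha hb
  have hθ : ∀ k l, 0 < theta ρ k l := fun k l => half_pos (add_pos (hρ.2 k) (hρ.2 l))
  have hF : ∀ k ∈ B, ∀ l ∈ Bᶜ, 0 < gradF W V β ρ l - gradF W V β ρ k := fun k hk l hl =>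
    sub_pos.2 (gradF_lt_gradF W V hβ hρ (hB k hk l (Finset.mem_compl.1 hl)))
  have hterm : ∀ k ∈ B, ∀ l ∈ Bᶜ,
      0 ≤ ω k l * theta ρ k l * (gradF W V β ρ l - gradF W V β ρ k) := fun k hk l hl =>
    mul_nonneg (mul_nonneg (hnonneg k l) (hθ k l).le) (hF k hk l hl).le
  rw [sum_neg_Lmat_mulVec hsymm hdiag]
  refine Finset.sum_pos' (fun k hk => Finset.sum_nonneg (hterm k hk)) ⟨i, hi, ?_⟩
  have hj' : j ∈ Bᶜ := Finset.mem_compl.2 hj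
  refine Finset.sum_pos' (hterm i hi) ⟨j, hj', ?_⟩
  exact mul_pos (mul_pos ((hnonneg i j).lt_of_ne' hij) (hθ i j)) (hF i hi j hj')

/-- The mass of every nonempty proper vertex set `B` stays above `μ c ^ (n - 1 - |B|)`, where
`c = (1 + (2M)^{1/β})⁻¹`, provided `μ ≤ c` and each vertex has initial mass above `μ`. -/
theorem IsSolution.lt_sum {ω : Fin n → Fin n → ℝ} (hG : IsGraph ω)
    {W : Matrix (Fin n) (Fin n) ℝ} {V : Fin n → ℝ} {β : ℝ} (hβ : 0 < β)
    {ρ : ℝ → Fin n → ℝ} (hsol : IsSolution ω W V β ρ) {μ c : ℝ}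
    (hc : c = 1 / (1 + (2 * Mconst W V) ^ (1 / β))) (hμ : 0 < μ) (hμc : μ ≤ c)
    (hinit : ∀ i, μ < ρ 0 i) {t : ℝ} (ht : t ∈ Set.Ici (0:ℝ)) {B : Finset (Fin n)}
    (hne : B.Nonempty) (hproper : B ≠ Finset.univ) :
    μ * c ^ (n - 1 - #B) < ∑ i ∈ B, ρ t i := by
  have hK : (0:ℝ) < (2 * Mconst W V) ^ (1 / β) :=
    Real.rpow_pos_of_pos (mul_pos two_pos (Real.exp_pos _)) _
  set K := (2 * Mconst W V) ^ (1 / β)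
  have hc0 : 0 < c := by rw [hc]; positivity
  have hcK : (1 + K) * c = 1 := by rw [hc]; field_simp
  have hc1 : c ≤ 1 := by nlinarith
  obtain ⟨hPo, hode⟩ := hsol
  refine sub_pos.1 (pos_of_deriv_pos_at_zero
    (ι := {B : Finset (Fin n) // B.Nonempty ∧ B ≠ Finset.univ})
    (fun B t => ∑ i ∈ B.1, ρ t i - μ * c ^ (n - 1 - #B.1))
    (fun B t => ∑ i ∈ B.1, (-(Lmat ω (ρ t)).mulVec (gradF W V β (ρ t))) i)
    ?_ ?_ ?_ t ht ⟨B, hne, hproper⟩)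
  · intro B t ht
    exact (HasDerivWithinAt.fun_sum fun i _ => hasDerivWithinAt_pi.1 (hode t ht) i).sub_const _
  · rintro ⟨B, ⟨i, hi⟩, -⟩
    refine sub_pos.2 ?_
    calc μ * c ^ (n - 1 - #B) ≤ μ := mul_le_of_le_one_right hμ.le (pow_le_one₀ hc0.le hc1)
      _ < ρ 0 i := hinit i
      _ ≤ ∑ i ∈ B, ρ 0 i := Finset.single_le_sum
          (fun k _ => ((hPo 0 Set.self_mem_Ici).2 k).le) hi
  · rintro t ht hall ⟨B, hne, hproper⟩ hzero
    have hρ := hPo t ht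
    have hzero : ∑ i ∈ B, ρ t i = μ * c ^ (n - 1 - #B) := sub_eq_zero.1 hzero
    refine flux_pos hG W V hβ hρ hne hproper fun i hi j hj => ?_
    have hle : ρ t i ≤ μ * c ^ (n - 1 - #B) := hzero ▸
      Finset.single_le_sum (fun k _ => (hρ.2 k).le) hi
    have hbig : (1 + K) * (μ * c ^ (n - 1 - #B)) ≤ ∑ k ∈ insert j B, ρ t k := by
      by_cases huniv : insert j B = Finset.univ
      · have hcard : #B + 1 = n := by
          rw [← Finset.card_insert_of_notMem hj, huniv, Finset.card_fin]
        rw [huniv, hρ.1, show n - 1 - #B = 0 by omega, pow_zero, mul_one]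
        nlinarith
      · have hcard : #B + 1 < n := by
          have := Finset.card_lt_univ_of_notMem (s := insert j B)
            (Classical.not_forall.1 (mt Finset.eq_univ_iff_forall.2 huniv)).choose_spec
          rwa [Finset.card_insert_of_notMem hj, Fintype.card_fin] at this
        have := sub_nonneg.1 (hall ⟨insert j B, Finset.insert_nonempty _ _, huniv⟩)
        refine le_trans (le_of_eq ?_) this
        simp only [Finset.card_insert_of_notMem hj]
        rw [show n - 1 - #B = (n - 1 - (#B + 1)) + 1 by omega, pow_succ]
        linear_combination (μ * c ^ (n - 1 - (#B + 1))) * hcK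
    rw [Finset.sum_insert hj, hzero] at hbig
    nlinarith

/-- the solution stays bounded below by `m(ρ⁰) > 0`. -/
theorem solution_lower_bound
    (n : ℕ) (hn : 2 ≤ n) (ω : Fin n → Fin n → ℝ) (hG : IsGraph ω)
    (W : Matrix (Fin n) (Fin n) ℝ) (hW : W.IsSymm) (V : Fin n → ℝ) (β : ℝ) (hβ : 0 < β)
    (ρ0 : Fin n → ℝ) (hρ0 : PoG ρ0)
    (ρ : ℝ → Fin n → ℝ) (hsol : IsSolution ω W V β ρ) (hinit : ρ 0 = ρ0) :
    0 < mconst W V β ρ0 ∧ ∀ t ∈ Set.Ici (0:ℝ), ∀ i, mconst W V β ρ0 ≤ ρ t i := by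
  have hn0 : Nonempty (Fin n) := ⟨⟨0, by omega⟩⟩
  have hmin : 0 < ⨅ i, ρ0 i := by
    obtain ⟨i, hi⟩ := exists_eq_ciInf_of_finite (f := ρ0)
    exact hi ▸ hρ0.2 i
  have hK : (0:ℝ) < (2 * Mconst W V) ^ (1 / β) :=
    Real.rpow_pos_of_pos (mul_pos two_pos (Real.exp_pos _)) _
  obtain ⟨c, hc⟩ : ∃ c, c = 1 / (1 + (2 * Mconst W V) ^ (1 / β)) := ⟨_, rfl⟩
  have hc0 : 0 < c := by rw [hc]; positivity
  have hpos : 0 < min c (⨅ i, ρ0 i) := lt_min hc0 hmin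
  have hm : mconst W V β ρ0 = (1 / 2 * min c (⨅ i, ρ0 i)) * c ^ (n - 2) := by
    rw [mconst, ← hc]; ring
  rw [hm]
  refine ⟨by positivity, fun t ht i => ?_⟩
  have hproper : ({i} : Finset (Fin n)) ≠ Finset.univ := by
    intro h
    have := congrArg Finset.card h
    rw [Finset.card_singleton, Finset.card_fin] at this
    omega
  have h := hsol.lt_sum hG hβ hc (μ := 1 / 2 * min c (⨅ i, ρ0 i)) (by positivity)
    (by linarith [min_le_left c (⨅ i, ρ0 i)])
    (fun k => by
      rw [hinit]
      linarith [min_le_right c (⨅ i, ρ0 i), ciInf_le (Set.finite_range ρ0).bddBelow k])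
    ht (Finset.singleton_nonempty i) hproper
  rw [Finset.sum_singleton, Finset.card_singleton, Nat.sub_sub] at h
  exact h.le

end FPEGraph
end
end

section
/- Let ρ∞ ∈ P_o(G) be a Gibbs measure, and assume there is λ > 0 with Hess𝓕(σ) ⪰ λ·I for all σ ∈ P_o(G). Then for every ρ ∈ P_o(G) with ρ_i ≥ m for all i (where 0 < m ≤ min_i ρ_i), one has F(ρ)^T L(ρ) F(ρ) ≥ 2·m·λ·λ_sec(L̂)·(𝓕(ρ) − 𝓕(ρ∞)). -/
open Finset Filter Matrix
open scoped Classical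

noncomputable section

namespace FPEGraph

variable {n : ℕ}

/-- The Dirichlet form of the Laplacian with symmetric weights `c` vanishing on the diagonal. -/
theorem dotProduct_Lhat_mulVec (c : Fin n → Fin n → ℝ) (hs : ∀ i j, c i j = c j i)
    (h0 : ∀ i, c i i = 0) (Φ : Fin n → ℝ) :
    Φ ⬝ᵥ (Lhat c).mulVec Φ = (1 / 2) * ∑ i, ∑ j, c i j * (Φ i - Φ j) ^ 2 := by
  have hmv : ∀ i, (Lhat c).mulVec Φ i = ∑ j, c i j * (Φ i - Φ j) := by
    intro i
    have h : ∀ j, Lhat c i j * Φ j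
        = (if i = j then (∑ k, c i k) * Φ i else 0) - c i j * Φ j := by
      intro j
      by_cases hij : i = j
      · subst hij
        simp [Lhat, h0]
      · simp [Lhat, hij]
    simp only [Matrix.mulVec, dotProduct, h, Finset.sum_sub_distrib, mul_sub, Finset.sum_ite_eq,
      Finset.mem_univ, if_true, Finset.sum_mul]
  have h1 : Φ ⬝ᵥ (Lhat c).mulVec Φ = ∑ i, ∑ j, Φ i * (c i j * (Φ i - Φ j)) := by
    simp only [dotProduct, hmv, Finset.mul_sum]
  have h2 : Φ ⬝ᵥ (Lhat c).mulVec Φ = ∑ i, ∑ j, Φ j * (c i j * (Φ j - Φ i)) := by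
    rw [h1, Finset.sum_comm]
    exact Finset.sum_congr rfl fun i _ => Finset.sum_congr rfl fun j _ => by rw [hs j i]
  have h3 : ∑ i, ∑ j, c i j * (Φ i - Φ j) ^ 2
      = ∑ i, ∑ j, Φ i * (c i j * (Φ i - Φ j)) + ∑ i, ∑ j, Φ j * (c i j * (Φ j - Φ i)) := by
    simp only [← Finset.sum_add_distrib]
    exact Finset.sum_congr rfl fun i _ => Finset.sum_congr rfl fun j _ => by ring
  rw [h3, ← h1, ← h2]
  ring

theorem dotProduct_Lhat_mulVec_nonneg (c : Fin n → Fin n → ℝ) (hs : ∀ i j, c i j = c j i)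
    (h0 : ∀ i, c i i = 0) (hc : ∀ i j, 0 ≤ c i j) (Φ : Fin n → ℝ) :
    0 ≤ Φ ⬝ᵥ (Lhat c).mulVec Φ := by
  rw [dotProduct_Lhat_mulVec c hs h0]
  exact mul_nonneg (by norm_num) (Finset.sum_nonneg fun i _ => Finset.sum_nonneg fun j _ =>
    mul_nonneg (hc i j) (sq_nonneg _))

theorem lamSec_nonneg {A : Matrix (Fin n) (Fin n) ℝ}
    (hA : ∀ Φ : Fin n → ℝ, 0 ≤ Φ ⬝ᵥ A.mulVec Φ) : 0 ≤ lamSec A := by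
  refine Real.sInf_nonneg ?_
  rintro x ⟨Φ, -, -, rfl⟩
  exact hA Φ

theorem lamSec_mul_le {A : Matrix (Fin n) (Fin n) ℝ}
    (hA : ∀ Φ : Fin n → ℝ, 0 ≤ Φ ⬝ᵥ A.mulVec Φ) (Φ : Fin n → ℝ) (hΦ : ∑ i, Φ i = 0) :
    lamSec A * ∑ i, Φ i ^ 2 ≤ Φ ⬝ᵥ A.mulVec Φ := by
  rcases (Finset.sum_nonneg fun i _ => sq_nonneg (Φ i) : 0 ≤ ∑ i, Φ i ^ 2).eq_or_lt with h | h
  · rw [← h, mul_zero]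
    exact hA Φ
  · have hs := Real.sqrt_pos.2 h
    have hq := Real.sq_sqrt h.le
    set s := √(∑ i, Φ i ^ 2)
    have hle : lamSec A ≤ (s⁻¹ • Φ) ⬝ᵥ A.mulVec (s⁻¹ • Φ) := by
      refine csInf_le ⟨0, ?_⟩ ⟨s⁻¹ • Φ, ?_, ?_, rfl⟩
      · rintro x ⟨Ψ, -, -, rfl⟩
        exact hA Ψ
      · simp [← Finset.mul_sum, hΦ]
      · simp only [Pi.smul_apply, smul_eq_mul, mul_pow, ← Finset.mul_sum]
        rw [← hq]
        field_simp
    rw [Matrix.mulVec_smul, smul_dotProduct, dotProduct_smul, smul_eq_mul, smul_eq_mul] at hle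
    calc lamSec A * ∑ i, Φ i ^ 2
        ≤ s⁻¹ * (s⁻¹ * Φ ⬝ᵥ A.mulVec Φ) * ∑ i, Φ i ^ 2 := by gcongr
      _ = Φ ⬝ᵥ A.mulVec Φ := by
        rw [← hq]
        field_simp

/-- Second-order Taylor lower bound on `[0, 1]`. -/
theorem add_deriv_add_half_le {f f' f'' : ℝ → ℝ} {c : ℝ}
    (hf : ∀ t ∈ Set.Icc (0 : ℝ) 1, HasDerivAt f (f' t) t)
    (hf' : ∀ t ∈ Set.Icc (0 : ℝ) 1, HasDerivAt f' (f'' t) t)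
    (hc : ∀ t ∈ Set.Icc (0 : ℝ) 1, c ≤ f'' t) :
    f 0 + f' 0 + c / 2 ≤ f 1 := by
  have mono : ∀ g g' : ℝ → ℝ, (∀ t ∈ Set.Icc (0 : ℝ) 1, HasDerivAt g (g' t) t) →
      (∀ t ∈ Set.Icc (0 : ℝ) 1, 0 ≤ g' t) → MonotoneOn g (Set.Icc 0 1) := by
    intro g g' hg hg'
    refine monotoneOn_of_hasDerivWithinAt_nonneg (f' := g') (convex_Icc 0 1)
      (fun t ht => (hg t ht).continuousAt.continuousWithinAt)
      (fun t ht => (hg t (interior_subset ht)).hasDerivWithinAt)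
      (fun t ht => hg' t (interior_subset ht))
  have h0 : (0 : ℝ) ∈ Set.Icc (0 : ℝ) 1 := by simp
  have h1 : (1 : ℝ) ∈ Set.Icc (0 : ℝ) 1 := by simp
  have m1 := mono (fun t => f' t - c * t) (fun t => f'' t - c * 1)
    (fun t ht => (hf' t ht).sub ((hasDerivAt_id t).const_mul c))
    (fun t ht => by linarith [hc t ht])
  have m2 := mono (fun t => f t - f' 0 * t - c / 2 * t ^ 2)
    (fun t => f' t - f' 0 * 1 - c / 2 * (2 * t))
    (fun t ht => by
      refine (((hf t ht).sub ((hasDerivAt_id t).const_mul (f' 0))).sub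
        ((hasDerivAt_pow 2 t).const_mul (c / 2))).congr_deriv ?_
      simp)
    (fun t ht => by
      have := m1 h0 ht ht.1
      simp only [mul_zero, sub_zero] at this
      linarith)
  have := m2 h0 h1 zero_le_one
  simp only at this
  linarith

theorem dotProduct_mulVec_swap {W : Matrix (Fin n) (Fin n) ℝ} (hW : W.IsSymm)
    (x y : Fin n → ℝ) : x ⬝ᵥ W.mulVec y = y ⬝ᵥ W.mulVec x := by
  rw [Matrix.dotProduct_mulVec, ← Matrix.mulVec_transpose, hW.eq, dotProduct_comm]

theorem hasDerivAt_freeEnergy_line {W : Matrix (Fin n) (Fin n) ℝ} (hW : W.IsSymm)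
    (V : Fin n → ℝ) (β : ℝ) (ρ d : Fin n → ℝ) (t : ℝ) (h : ∀ i, 0 < (ρ + t • d) i) :
    HasDerivAt (fun s : ℝ => freeEnergy W V β (ρ + s • d))
      (gradF W V β (ρ + t • d) ⬝ᵥ d) t := by
  have hline : ∀ i, HasDerivAt (fun s : ℝ => (ρ + s • d) i) (d i) t := fun i => by
    simpa using ((hasDerivAt_id t).mul_const (d i)).const_add (ρ i)
  have hmv : ∀ i, HasDerivAt (fun s : ℝ => W.mulVec (ρ + s • d) i) (W.mulVec d i) t := fun i => by
    simpa [Matrix.mulVec_add, Matrix.mulVec_smul] using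
      ((hasDerivAt_id t).mul_const (W.mulVec d i)).const_add (W.mulVec ρ i)
  have hquad := (HasDerivAt.fun_sum fun i (_ : i ∈ Finset.univ) =>
    (hline i).mul (hmv i)).const_mul (1 / 2)
  have hlin := HasDerivAt.fun_sum fun i (_ : i ∈ Finset.univ) => (hline i).const_mul (V i)
  have hent := (HasDerivAt.fun_sum fun i (_ : i ∈ Finset.univ) =>
    (hline i).mul ((hline i).log (h i).ne')).const_mul β
  refine ((hquad.add hlin).add hent).congr_deriv ?_
  have hsw := dotProduct_mulVec_swap hW (ρ + t • d) d
  simp only [dotProduct] at hsw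
  rw [Finset.sum_add_distrib, hsw]
  simp only [dotProduct, gradF]
  have : ∀ i, (ρ + t • d) i * (d i / (ρ + t • d) i) = d i := fun i =>
    mul_div_cancel₀ _ (h i).ne'
  simp only [this, Finset.mul_sum, ← Finset.sum_add_distrib]
  exact Finset.sum_congr rfl fun i _ => by ring

theorem hasDerivAt_gradF_line (W : Matrix (Fin n) (Fin n) ℝ) (V : Fin n → ℝ) (β : ℝ)
    (ρ d : Fin n → ℝ) (t : ℝ) (h : ∀ i, 0 < (ρ + t • d) i) :
    HasDerivAt (fun s : ℝ => gradF W V β (ρ + s • d) ⬝ᵥ d)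
      (d ⬝ᵥ (hessF W β (ρ + t • d)).mulVec d) t := by
  have hline : ∀ i, HasDerivAt (fun s : ℝ => (ρ + s • d) i) (d i) t := fun i => by
    simpa using ((hasDerivAt_id t).mul_const (d i)).const_add (ρ i)
  have hmv : ∀ i, HasDerivAt (fun s : ℝ => W.mulVec (ρ + s • d) i) (W.mulVec d i) t := fun i => by
    simpa [Matrix.mulVec_add, Matrix.mulVec_smul] using
      ((hasDerivAt_id t).mul_const (W.mulVec d i)).const_add (W.mulVec ρ i)
  have hsum := HasDerivAt.fun_sum fun i (_ : i ∈ Finset.univ) =>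
    ((((hmv i).const_add (V i)).add
      (((hline i).log (h i).ne').const_mul β)).add_const β).mul_const (d i)
  refine hsum.congr_deriv ?_
  simp only [dotProduct, hessF, Matrix.add_mulVec, Matrix.smul_mulVec, Pi.add_apply,
    Pi.smul_apply, Matrix.mulVec_diagonal, smul_eq_mul]
  exact Finset.sum_congr rfl fun i _ => by ring

/-- Strong convexity of the free energy on the open simplex. -/
theorem freeEnergy_strong_convex {W : Matrix (Fin n) (Fin n) ℝ} (hW : W.IsSymm)
    (V : Fin n → ℝ) (β lam : ℝ)
    (hHess : ∀ σ : Fin n → ℝ, PoG σ → ∀ Φ : Fin n → ℝ,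
      lam * (∑ i, (Φ i)^2) ≤ Φ ⬝ᵥ (hessF W β σ).mulVec Φ)
    {ρ σ : Fin n → ℝ} (hρ : PoG ρ) (hσ : PoG σ) :
    freeEnergy W V β ρ + gradF W V β ρ ⬝ᵥ (σ - ρ) + lam * (∑ i, (σ i - ρ i) ^ 2) / 2
      ≤ freeEnergy W V β σ := by
  have hseg : ∀ t ∈ Set.Icc (0 : ℝ) 1, PoG (ρ + t • (σ - ρ)) := by
    intro t ht
    refine ⟨?_, fun i => ?_⟩
    · simp [Finset.sum_add_distrib, ← Finset.mul_sum, hρ.1, hσ.1]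
    · have hi : (ρ + t • (σ - ρ)) i = (1 - t) * ρ i + t * σ i := by
        simp
        ring
      rw [hi]
      rcases ht.1.eq_or_lt with rfl | h0
      · simpa using hρ.2 i
      · exact add_pos_of_nonneg_of_pos (mul_nonneg (by linarith [ht.2]) (hρ.2 i).le)
          (mul_pos h0 (hσ.2 i))
  have := add_deriv_add_half_le
    (fun t ht => hasDerivAt_freeEnergy_line hW V β ρ (σ - ρ) t (hseg t ht).2)
    (fun t ht => hasDerivAt_gradF_line W V β ρ (σ - ρ) t (hseg t ht).2)
    (fun t ht => hHess _ (hseg t ht) (σ - ρ))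
  simpa using this

/-- dissipation lower bound
`F(ρ)ᵀ L(ρ) F(ρ) ≥ 2 m λ λ_sec(L̂) (𝓕(ρ) - 𝓕(ρ∞))`. -/
theorem fisher_lower_bound
    (n : ℕ) (hn : 2 ≤ n) (ω : Fin n → Fin n → ℝ) (hG : IsGraph ω)
    (W : Matrix (Fin n) (Fin n) ℝ) (hW : W.IsSymm) (V : Fin n → ℝ) (β : ℝ) (hβ : 0 < β)
    (ρinf : Fin n → ℝ) (hGibbs : IsGibbs W V β ρinf)
    (lam : ℝ) (hlam : 0 < lam)
    (hHess : ∀ σ : Fin n → ℝ, PoG σ → ∀ Φ : Fin n → ℝ,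
      lam * (∑ i, (Φ i)^2) ≤ Φ ⬝ᵥ (hessF W β σ).mulVec Φ)
    (ρ : Fin n → ℝ) (hρ : PoG ρ) (m : ℝ) (hm : 0 < m) (hmρ : ∀ i, m ≤ ρ i) :
    2 * m * lam * lamSec (Lhat ω) * (freeEnergy W V β ρ - freeEnergy W V β ρinf) ≤
      gradF W V β ρ ⬝ᵥ (Lmat ω ρ).mulVec (gradF W V β ρ) := by
  obtain ⟨hs, h0, hnn, -⟩ := hG
  have hpsd := dotProduct_Lhat_mulVec_nonneg ω hs h0 hnn
  set F := gradF W V β ρ with hF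
  set a : ℝ := (∑ i, F i) / n with ha
  set G : Fin n → ℝ := fun i => F i - a with hGdef
  have hn0 : (n : ℝ) ≠ 0 := by
    have : n ≠ 0 := by omega
    exact_mod_cast this
  have hGsum : ∑ i, G i = 0 := by
    simp only [hGdef, Finset.sum_sub_distrib, Finset.sum_const, Finset.card_univ, Fintype.card_fin,
      nsmul_eq_mul, ha]
    field_simp
    ring
  have hdiss : m * (G ⬝ᵥ (Lhat ω).mulVec G) ≤ F ⬝ᵥ (Lmat ω ρ).mulVec F := by
    have hL : Lmat ω ρ = Lhat fun i j => ω i j * theta ρ i j := rfl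
    rw [hL, dotProduct_Lhat_mulVec ω hs h0, dotProduct_Lhat_mulVec _
      (fun i j => by rw [hs i j, theta, theta, add_comm]) (fun i => by rw [h0 i, zero_mul]),
      mul_left_comm, Finset.mul_sum]
    refine mul_le_mul_of_nonneg_left (Finset.sum_le_sum fun i _ => ?_) (by norm_num)
    rw [Finset.mul_sum]
    refine Finset.sum_le_sum fun j _ => ?_
    have hθ : m ≤ theta ρ i j := by
      rw [theta]
      linarith [hmρ i, hmρ j]
    calc m * (ω i j * (G i - G j) ^ 2) = ω i j * m * (F i - F j) ^ 2 := by
          simp only [hGdef]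
          ring
      _ ≤ ω i j * theta ρ i j * (F i - F j) ^ 2 := by
          have := hnn i j
          gcongr
  have hPL : 2 * lam * (freeEnergy W V β ρ - freeEnergy W V β ρinf) ≤ ∑ i, G i ^ 2 := by
    have hconv := freeEnergy_strong_convex hW V β lam hHess hρ hGibbs.1
    have hdot : F ⬝ᵥ (ρinf - ρ) = ∑ i, G i * (ρinf i - ρ i) := by
      simp [hGdef, dotProduct, sub_mul, Finset.sum_sub_distrib, ← Finset.mul_sum, hρ.1,
        hGibbs.1.1]
    have hsq : 0 ≤ ∑ i, (G i + lam * (ρinf i - ρ i)) ^ 2 :=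
      Finset.sum_nonneg fun i _ => sq_nonneg _
    have hexp : ∑ i, (G i + lam * (ρinf i - ρ i)) ^ 2 = ∑ i, G i ^ 2
        + 2 * lam * ∑ i, G i * (ρinf i - ρ i) + lam ^ 2 * ∑ i, (ρinf i - ρ i) ^ 2 := by
      simp only [Finset.mul_sum, ← Finset.sum_add_distrib]
      exact Finset.sum_congr rfl fun i _ => by ring
    rw [hdot] at hconv
    rw [hexp] at hsq
    have := mul_le_mul_of_nonneg_left hconv (by positivity : 0 ≤ 2 * lam)
    linarith
  calc 2 * m * lam * lamSec (Lhat ω) * (freeEnergy W V β ρ - freeEnergy W V β ρinf)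
      = m * (lamSec (Lhat ω) *
          (2 * lam * (freeEnergy W V β ρ - freeEnergy W V β ρinf))) := by ring
    _ ≤ m * (lamSec (Lhat ω) * ∑ i, G i ^ 2) := by
        have := lamSec_nonneg hpsd
        gcongr
    _ ≤ m * (G ⬝ᵥ (Lhat ω).mulVec G) := by
        gcongr
        exact lamSec_mul_le hpsd G hGsum
    _ ≤ _ := hdiss

end FPEGraph
end
end
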